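/- Let g : ℝⁿ → ℝ be twice continuously differentiable on an open set U ⊆ ℝⁿ, let V ⊆ ℝ be open with g(U) ⊆ V, let r : V → ℝ be twice continuously differentiable, and let B ⊆ U. Let I_g ⊊ L_g ⊊ {1,…,n} be index sets such that g is independent of x_i for all i ∈ I_g and g depends at most linearly on x_i for all i ∈ L_g, and set J = I_gᶜ with |J| ≥ 2. Suppose that for all x ∈ B: r̲′ ≤ r′(g(x)) ≤ r̄′, r̲″ ≤ r″(g(x)) ≤ r̄″, every eigenvalue of ∇²_{L_gᶜ} g(x) lies in [λ̲_g, λ̄_g], and ∂g/∂x_i(x) ∈ [u̲_i, ū_i] for every i ∈ J. Set s = Σ_{i∈J} max{u̲_i², ū_i²}. Then for every x ∈ B every eigenvalue of the reduced Hessian ∇²_J (r∘g)(x) lies in the interval sum [r̲″, r̄″]·[0, s] + [r̲′, r̄′]·[min{λ̲_g, 0}, max{λ̄_g, 0}], where · denotes interval multiplication and + interval addition. -/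

import Mathlib

open scoped BigOperators

/-- First partial derivative `∂f/∂x_i (x)`. -/
noncomputable def pd {n : ℕ} (f : (Fin n → ℝ) → ℝ) (i : Fin n) (x : Fin n → ℝ) : ℝ :=
  fderiv ℝ f x (Pi.single i 1)

/-- Second partial derivative `∂²f/∂x_i∂x_j (x)` (differentiate w.r.t. `x_j` first, then `x_i`). -/
noncomputable def pd2 {n : ℕ} (f : (Fin n → ℝ) → ℝ) (i j : Fin n) (x : Fin n → ℝ) : ℝ :=
  pd (fun y => pd f j y) i x

/-- Hessian matrix `∇²f(x)` with entries `(∇²f(x))_{ij} = ∂²f/∂x_i∂x_j (x)`. -/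
noncomputable def hess {n : ℕ} (f : (Fin n → ℝ) → ℝ) (x : Fin n → ℝ) :
    Matrix (Fin n) (Fin n) ℝ :=
  Matrix.of fun i j => pd2 f i j x

/-- Reduced Hessian `∇²_J f(x)` indexed by the elements of `J` in ascending order. -/
noncomputable def redHess {n : ℕ} (f : (Fin n → ℝ) → ℝ) (J : Finset (Fin n)) (x : Fin n → ℝ) :
    Matrix (Fin J.card) (Fin J.card) ℝ :=
  Matrix.of fun i j => pd2 f (J.orderIsoOfFin rfl i).1 (J.orderIsoOfFin rfl j).1 x

/-- Every eigenvalue of the (symmetric) matrix `M` lies in `[lo, hi]`. -/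
def eigsIn {m : ℕ} (M : Matrix (Fin m) (Fin m) ℝ) (lo hi : ℝ) : Prop :=
  ∀ (μ : ℝ) (v : Fin m → ℝ), v ≠ 0 → M.mulVec v = μ • v → lo ≤ μ ∧ μ ≤ hi

/-- Lower endpoint of the interval product `[a,b]·[c,d]`. -/
def imulLo (a b c d : ℝ) : ℝ := min (min (a * c) (a * d)) (min (b * c) (b * d))

/-- Upper endpoint of the interval product `[a,b]·[c,d]`. -/
def imulHi (a b c d : ℝ) : ℝ := max (max (a * c) (a * d)) (max (b * c) (b * d))

/-- Second partial derivatives are the entries of the second Fréchet derivative. -/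
lemma pd2_eq_fderiv_fderiv {n : ℕ} {f : (Fin n → ℝ) → ℝ} {x : Fin n → ℝ}
    (hf : ContDiffAt ℝ 2 f x) (i j : Fin n) :
    pd2 f i j x = fderiv ℝ (fderiv ℝ f) x (Pi.single i 1) (Pi.single j 1) := by
  have hd : DifferentiableAt ℝ (fderiv ℝ f) x :=
    (hf.fderiv_right (m := 1) (by norm_num)).differentiableAt (by norm_num)
  have h := hd.hasFDerivAt.clm_apply (hasFDerivAt_const (Pi.single j (1 : ℝ)) x)
  simp only [pd2, pd]
  rw [h.fderiv]
  simp

lemma pd2_comm {n : ℕ} {f : (Fin n → ℝ) → ℝ} {x : Fin n → ℝ}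
    (hf : ContDiffAt ℝ 2 f x) (i j : Fin n) : pd2 f i j x = pd2 f j i x := by
  rw [pd2_eq_fderiv_fderiv hf, pd2_eq_fderiv_fderiv hf]
  exact (hf.isSymmSndFDerivAt (by simp)).eq _ _

lemma differentiableAt_pd {n : ℕ} {f : (Fin n → ℝ) → ℝ} {x : Fin n → ℝ}
    (hf : ContDiffAt ℝ 2 f x) (i : Fin n) : DifferentiableAt ℝ (fun y => pd f i y) x :=
  ((hf.fderiv_right (m := 1) (by norm_num)).differentiableAt (by norm_num)).clm_apply
    (differentiableAt_const _)

lemma pd2_eq_zero_of_pd_const {n : ℕ} {f : (Fin n → ℝ) → ℝ} {U : Set (Fin n → ℝ)}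
    (hU : IsOpen U) {x : Fin n → ℝ} (hx : x ∈ U) {j : Fin n} {c : ℝ}
    (hc : ∀ y ∈ U, pd f j y = c) (i : Fin n) : pd2 f i j x = 0 := by
  have h : (fun y => pd f j y) =ᶠ[nhds x] fun _ => c :=
    Filter.eventuallyEq_of_mem (hU.mem_nhds hx) hc
  rw [pd2, pd, h.fderiv_eq]
  simp

lemma pd_comp {n : ℕ} {g : (Fin n → ℝ) → ℝ} {r : ℝ → ℝ} {x : Fin n → ℝ}
    (hg : DifferentiableAt ℝ g x) (hr : DifferentiableAt ℝ r (g x)) (j : Fin n) :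
    pd (fun y => r (g y)) j x = deriv r (g x) * pd g j x := by
  have h := hr.hasDerivAt.comp_hasFDerivAt x hg.hasFDerivAt
  have h' : fderiv ℝ (fun y => r (g y)) x = deriv r (g x) • fderiv ℝ g x := h.fderiv
  simp [pd, h']

/-- Second-order chain rule for partial derivatives. -/
lemma pd2_comp {n : ℕ} {g : (Fin n → ℝ) → ℝ} {r : ℝ → ℝ} {U : Set (Fin n → ℝ)} {V : Set ℝ}
    (hU : IsOpen U) (hg : ContDiffOn ℝ 2 g U) (hV : IsOpen V) (hgV : Set.MapsTo g U V)
    (hr : ContDiffOn ℝ 2 r V) {x : Fin n → ℝ} (hx : x ∈ U) (i j : Fin n) :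
    pd2 (fun y => r (g y)) i j x =
      deriv (deriv r) (g x) * (pd g i x * pd g j x) + deriv r (g x) * pd2 g i j x := by
  have hgAt : ∀ y ∈ U, ContDiffAt ℝ 2 g y := fun y hy => hg.contDiffAt (hU.mem_nhds hy)
  have hrAt : ∀ y ∈ U, ContDiffAt ℝ 2 r (g y) :=
    fun y hy => hr.contDiffAt (hV.mem_nhds (hgV hy))
  have hpd : (fun y => pd (fun z => r (g z)) j y) =ᶠ[nhds x]
      fun y => deriv r (g y) * pd g j y :=
    Filter.eventuallyEq_of_mem (hU.mem_nhds hx) fun y hy =>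
      pd_comp ((hgAt y hy).differentiableAt (by norm_num))
        ((hrAt y hy).differentiableAt (by norm_num)) j
  have hgd : DifferentiableAt ℝ g x := (hgAt x hx).differentiableAt (by norm_num)
  have hrd : DifferentiableAt ℝ (deriv r) (g x) :=
    ((hr.deriv_of_isOpen hV (m := 1) (by norm_num)).contDiffAt
      (hV.mem_nhds (hgV hx))).differentiableAt (by norm_num)
  have hderiv := hrd.hasDerivAt.comp_hasFDerivAt x hgd.hasFDerivAt
  have hmul := hderiv.mul (differentiableAt_pd (hgAt x hx) j).hasFDerivAt
  have hmul' : fderiv ℝ (fun y => deriv r (g y) * pd g j y) x = _ := hmul.fderiv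
  simp only [pd2]
  rw [pd, hpd.fderiv_eq, hmul']
  simp only [Function.comp_apply, add_apply, smul_apply, smul_eq_mul, pd]
  ring

/-- A symmetric matrix whose eigenvalues are bounded below by `lo` has Rayleigh quotient at least
`lo`. -/
lemma le_dotProduct_mulVec_of_eigenvalues {m : ℕ} {M : Matrix (Fin m) (Fin m) ℝ}
    (hM : M.IsHermitian) {lo : ℝ}
    (h : ∀ (μ : ℝ) (v : Fin m → ℝ), v ≠ 0 → M.mulVec v = μ • v → lo ≤ μ) (v : Fin m → ℝ) :
    lo * (v ⬝ᵥ v) ≤ v ⬝ᵥ M.mulVec v := by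
  have hA : (M - lo • (1 : Matrix (Fin m) (Fin m) ℝ)).IsHermitian :=
    hM.sub (by simp [Matrix.IsHermitian])
  have hpos : (M - lo • (1 : Matrix (Fin m) (Fin m) ℝ)).PosSemidef := by
    refine hA.posSemidef_iff_eigenvalues_nonneg.2 fun i => ?_
    have hv := hA.mulVec_eigenvectorBasis i
    have hne : (hA.eigenvectorBasis i).ofLp ≠ 0 := fun h0 =>
      hA.eigenvectorBasis.orthonormal.ne_zero i (by ext k; simp [h0])
    have := h (hA.eigenvalues i + lo) _ hne (by
      rw [Matrix.sub_mulVec, Matrix.smul_mulVec, Matrix.one_mulVec] at hv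
      rw [add_smul, ← hv, sub_add_cancel])
    simpa using this
  have := hpos.dotProduct_mulVec_nonneg v
  simp only [star_trivial, Matrix.sub_mulVec, Matrix.smul_mulVec, Matrix.one_mulVec,
    dotProduct_sub, dotProduct_smul, smul_eq_mul] at this
  linarith

lemma eigsIn.dotProduct_mulVec_mem {m : ℕ} {M : Matrix (Fin m) (Fin m) ℝ}
    (hM : M.IsHermitian) {lo hi : ℝ} (h : eigsIn M lo hi) (v : Fin m → ℝ) :
    lo * (v ⬝ᵥ v) ≤ v ⬝ᵥ M.mulVec v ∧ v ⬝ᵥ M.mulVec v ≤ hi * (v ⬝ᵥ v) := by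
  refine ⟨le_dotProduct_mulVec_of_eigenvalues hM (fun μ v h0 hv => (h μ v h0 hv).1) v, ?_⟩
  have := le_dotProduct_mulVec_of_eigenvalues (lo := -hi) hM.neg (fun μ v h0 hv => by
    have := (h (-μ) v h0 (by rw [neg_smul, ← hv, Matrix.neg_mulVec, neg_neg])).2
    linarith) v
  rw [Matrix.neg_mulVec, dotProduct_neg] at this
  linarith

lemma sum_orderIsoOfFin {n : ℕ} (J : Finset (Fin n)) (F : Fin n → ℝ) :
    ∑ k, F (J.orderIsoOfFin rfl k).1 = ∑ i ∈ J, F i := by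
  rw [← Finset.sum_coe_sort J]
  exact (J.orderIsoOfFin rfl).toEquiv.sum_comp fun i => F i.1

/-- The quadratic form of the reduced Hessian as a double sum over the index set. -/
lemma dotProduct_redHess_mulVec {n : ℕ} (f : (Fin n → ℝ) → ℝ) (J : Finset (Fin n))
    (x w : Fin n → ℝ) :
    (fun k => w (J.orderIsoOfFin rfl k).1) ⬝ᵥ
        (redHess f J x).mulVec (fun k => w (J.orderIsoOfFin rfl k).1) =
      ∑ i ∈ J, ∑ j ∈ J, w i * (pd2 f i j x * w j) := by
  simp only [dotProduct, Matrix.mulVec, redHess, Matrix.of_apply]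
  rw [← sum_orderIsoOfFin J]
  refine Finset.sum_congr rfl fun k _ => ?_
  rw [sum_orderIsoOfFin J fun j => pd2 f (J.orderIsoOfFin rfl k).1 j x * w j, Finset.mul_sum]

lemma dotProduct_orderIsoOfFin {n : ℕ} (J : Finset (Fin n)) (w : Fin n → ℝ) :
    (fun k => w (J.orderIsoOfFin rfl k).1) ⬝ᵥ (fun k => w (J.orderIsoOfFin rfl k).1) =
      ∑ i ∈ J, w i ^ 2 := by
  simp only [dotProduct, ← sq]
  exact sum_orderIsoOfFin J fun i => w i ^ 2

lemma exists_extend_orderIsoOfFin {n : ℕ} (J : Finset (Fin n)) (v : Fin J.card → ℝ) :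
    ∃ w : Fin n → ℝ, v = fun k => w (J.orderIsoOfFin rfl k).1 := by
  refine ⟨fun i => if h : i ∈ J then v ((J.orderIsoOfFin rfl).symm ⟨i, h⟩) else 0, ?_⟩
  funext k
  beta_reduce
  rw [dif_pos (J.orderIsoOfFin rfl k).2]
  exact congrArg v ((J.orderIsoOfFin rfl).symm_apply_apply k).symm

lemma min_mul_le_mul_of_mem {x y c d : ℝ} (hy : c ≤ y ∧ y ≤ d) :
    min (x * c) (x * d) ≤ x * y ∧ x * y ≤ max (x * c) (x * d) := by
  rcases le_total 0 x with hx | hx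
  · exact ⟨min_le_of_left_le (mul_le_mul_of_nonneg_left hy.1 hx),
      le_max_of_le_right (mul_le_mul_of_nonneg_left hy.2 hx)⟩
  · exact ⟨min_le_of_right_le (mul_le_mul_of_nonpos_left hy.2 hx),
      le_max_of_le_left (mul_le_mul_of_nonpos_left hy.1 hx)⟩

lemma mul_mem_imul {a b c d x y : ℝ} (hx : a ≤ x ∧ x ≤ b) (hy : c ≤ y ∧ y ≤ d) :
    imulLo a b c d ≤ x * y ∧ x * y ≤ imulHi a b c d := by
  have h := min_mul_le_mul_of_mem (x := y) hx
  have ha := min_mul_le_mul_of_mem (x := a) hy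
  have hb := min_mul_le_mul_of_mem (x := b) hy
  rw [mul_comm y a, mul_comm y b, mul_comm y x] at h
  exact ⟨(min_le_min ha.1 hb.1).trans h.1, h.2.trans (max_le_max ha.2 hb.2)⟩

theorem stmt14 {n : ℕ} (hn : 0 < n) (U B : Set (Fin n → ℝ)) (hU : IsOpen U) (hBU : B ⊆ U)
    (g : (Fin n → ℝ) → ℝ) (hg : ContDiffOn ℝ 2 g U)
    (V : Set ℝ) (hV : IsOpen V) (hgV : Set.MapsTo g U V)
    (r : ℝ → ℝ) (hr : ContDiffOn ℝ 2 r V)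
    (Ig Lg : Finset (Fin n)) (hIL : Ig ⊂ Lg) (hLU : Lg ⊂ Finset.univ)
    (hind : ∀ i ∈ Ig, ∀ x ∈ U, pd g i x = 0)
    (hlin : ∀ i ∈ Lg, ∃ c : ℝ, ∀ x ∈ U, pd g i x = c)
    (J : Finset (Fin n)) (hJ : J = Igᶜ) (hJ2 : 2 ≤ J.card)
    (r1lo r1hi r2lo r2hi lamlo lamhi : ℝ) (ulo uhi : Fin n → ℝ)
    (hr1I : r1lo ≤ r1hi) (hr2I : r2lo ≤ r2hi) (hlamI : lamlo ≤ lamhi)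
    (huI : ∀ i ∈ J, ulo i ≤ uhi i)
    (hr1 : ∀ x ∈ B, r1lo ≤ deriv r (g x) ∧ deriv r (g x) ≤ r1hi)
    (hr2 : ∀ x ∈ B, r2lo ≤ deriv (deriv r) (g x) ∧ deriv (deriv r) (g x) ≤ r2hi)
    (hlam : ∀ x ∈ B, eigsIn (redHess g Lgᶜ x) lamlo lamhi)
    (hu : ∀ x ∈ B, ∀ i ∈ J, ulo i ≤ pd g i x ∧ pd g i x ≤ uhi i) :
    ∀ x ∈ B, eigsIn (redHess (fun y => r (g y)) J x)
      (imulLo r2lo r2hi 0 (∑ i ∈ J, max ((ulo i) ^ 2) ((uhi i) ^ 2)) +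
        imulLo r1lo r1hi (min lamlo 0) (max lamhi 0))
      (imulHi r2lo r2hi 0 (∑ i ∈ J, max ((ulo i) ^ 2) ((uhi i) ^ 2)) +
        imulHi r1lo r1hi (min lamlo 0) (max lamhi 0)) := by
  subst hJ
  intro x hx μ v hv0 hv
  have hxU : x ∈ U := hBU hx
  have hgx : ContDiffAt ℝ 2 g x := hg.contDiffAt (hU.mem_nhds hxU)
  obtain ⟨w, rfl⟩ := exists_extend_orderIsoOfFin _ v
  set N := ∑ i ∈ Igᶜ, w i ^ 2 with hN
  set S := ∑ i ∈ Igᶜ, pd g i x * w i with hS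
  set Q := ∑ i ∈ Igᶜ, ∑ j ∈ Igᶜ, w i * (pd2 g i j x * w j) with hQ
  set s := ∑ i ∈ Igᶜ, max ((ulo i) ^ 2) ((uhi i) ^ 2) with hs
  have hNpos : 0 < N := by
    have hnn : 0 ≤ N := Finset.sum_nonneg fun i _ => sq_nonneg _
    refine lt_of_le_of_ne hnn fun h0 => hv0 ?_
    rw [← dotProduct_self_eq_zero, dotProduct_orderIsoOfFin, ← hN, ← h0]
  have hform : μ * N = deriv (deriv r) (g x) * S ^ 2 + deriv r (g x) * Q := by
    have h := congrArg (fun z => (fun k => w ((Igᶜ).orderIsoOfFin rfl k).1) ⬝ᵥ z) hv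
    simp only [dotProduct_redHess_mulVec, dotProduct_smul, dotProduct_orderIsoOfFin,
      smul_eq_mul] at h
    rw [hN, ← h, hQ, sq, hS, Finset.sum_mul_sum, Finset.mul_sum, Finset.mul_sum,
      ← Finset.sum_add_distrib]
    refine Finset.sum_congr rfl fun i _ => ?_
    rw [Finset.mul_sum, Finset.mul_sum, ← Finset.sum_add_distrib]
    refine Finset.sum_congr rfl fun j _ => ?_
    rw [pd2_comp hU hg hV hgV hr hxU]
    ring
  have hSle : S ^ 2 ≤ s * N := by
    refine (Finset.sum_mul_sq_le_sq_mul_sq _ _ _).trans ?_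
    refine mul_le_mul_of_nonneg_right (Finset.sum_le_sum fun i hi => ?_) hNpos.le
    obtain ⟨h1, h2⟩ := hu x hx i hi
    rcases le_total 0 (pd g i x) with h | h
    · exact le_max_of_le_right (by nlinarith)
    · exact le_max_of_le_left (by nlinarith)
  have hsub : Lgᶜ ⊆ Igᶜ := Finset.compl_subset_compl.2 hIL.1
  have hzero : ∀ i, ∀ j ∈ Lg, pd2 g i j x = 0 := fun i j hj => by
    obtain ⟨c, hc⟩ := hlin j hj
    exact pd2_eq_zero_of_pd_const hU hxU hc i
  have hQL : Q = ∑ i ∈ Lgᶜ, ∑ j ∈ Lgᶜ, w i * (pd2 g i j x * w j) := by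
    rw [hQ, ← Finset.sum_subset hsub]
    · refine Finset.sum_congr rfl fun i _ => (Finset.sum_subset hsub fun j _ hj => ?_).symm
      simp [hzero i j (by simpa using hj)]
    · intro i _ hi
      refine Finset.sum_eq_zero fun j _ => ?_
      simp [pd2_comm hgx i j, hzero j i (by simpa using hi)]
  have hherm : (redHess g Lgᶜ x).IsHermitian := by
    ext i j
    simp [redHess, pd2_comm hgx]
  have hray := (hlam x hx).dotProduct_mulVec_mem hherm fun k => w ((Lgᶜ).orderIsoOfFin rfl k).1
  rw [dotProduct_redHess_mulVec, dotProduct_orderIsoOfFin, ← hQL] at hray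
  have hNL : ∑ i ∈ Lgᶜ, w i ^ 2 ≤ N :=
    Finset.sum_le_sum_of_subset_of_nonneg hsub fun i _ _ => sq_nonneg _
  have hNL0 : 0 ≤ ∑ i ∈ Lgᶜ, w i ^ 2 := Finset.sum_nonneg fun i _ => sq_nonneg _
  have hQmem : min lamlo 0 ≤ Q / N ∧ Q / N ≤ max lamhi 0 := by
    rw [le_div_iff₀ hNpos, div_le_iff₀ hNpos]
    constructor
    · exact ((mul_le_mul_of_nonpos_left hNL (min_le_right _ _)).trans
        (mul_le_mul_of_nonneg_right (min_le_left _ _) hNL0)).trans hray.1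
    · exact hray.2.trans ((mul_le_mul_of_nonneg_right (le_max_left _ _) hNL0).trans
        (mul_le_mul_of_nonneg_left hNL (le_max_right _ _)))
  have hSmem : 0 ≤ S ^ 2 / N ∧ S ^ 2 / N ≤ s :=
    ⟨by positivity, (div_le_iff₀ hNpos).2 hSle⟩
  have hμ : μ = deriv (deriv r) (g x) * (S ^ 2 / N) + deriv r (g x) * (Q / N) := by
    field_simp
    linarith
  have h1 := mul_mem_imul (hr2 x hx) hSmem
  have h2 := mul_mem_imul (hr1 x hx) hQmem
  rw [hμ]
  exact ⟨add_le_add h1.1 h2.1, add_le_add h1.2 h2.2⟩
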